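/- For any S-complex C~ over a commutative ring R, the negative suspension Σ⁻¹C~ is S-chain homotopy equivalent to the tensor product C~ ⊗ O~(−1). -/

import Mathlib

set_option maxHeartbeats 1000000

open Function

universe u

/-- A `ℤ`-graded `R`-module, presented as an `R`-module together with a family of submodules
(the homogeneous pieces). -/
structure GradedMod (R : Type u) [CommRing R] : Type (u + 1) where
  carrier : Type u
  [isAddCommGroup : AddCommGroup carrier]
  [isModule : Module R carrier]
  grading : ℤ → Submodule R carrier

attribute [instance] GradedMod.isAddCommGroup GradedMod.isModule

namespace GradedMod

variable {R : Type u} [CommRing R]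

/-- `f` is homogeneous of degree `k` with respect to the gradings. -/
def IsDeg (M N : GradedMod R) (k : ℤ) (f : M.carrier →ₗ[R] N.carrier) : Prop :=
  ∀ i : ℤ, (M.grading i).map f ≤ N.grading (i + k)

/-- The grading is an internal direct sum decomposition with finitely generated free pieces,
only finitely many of which are nonzero; i.e., the graded module is finitely generated and
free as a graded `R`-module. -/
def IsFGFree (M : GradedMod R) : Prop :=
  DirectSum.IsInternal M.grading ∧ (∀ i : ℤ, Module.Free R ↥(M.grading i)) ∧
    (∀ i : ℤ, Module.Finite R ↥(M.grading i)) ∧ {i : ℤ | M.grading i ≠ ⊥}.Finite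

/-- `e` is the sign operator `ε`, acting on the degree `i` homogeneous part by `(-1)^i`. -/
def IsSign (M : GradedMod R) (e : M.carrier →ₗ[R] M.carrier) : Prop :=
  ∀ i : ℤ, ∀ x ∈ M.grading i, e x = if Even i then x else -x

/-- The shift `M[n]`, with `M[n]_j = M_{n+j}`. -/
def shift (M : GradedMod R) (n : ℤ) : GradedMod R where
  carrier := M.carrier
  grading j := M.grading (n + j)

/-- Direct sum (product) of graded modules. -/
def prodGM (M N : GradedMod R) : GradedMod R where
  carrier := M.carrier × N.carrier
  grading j := (M.grading j).prod (N.grading j)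

/-- Tensor product of graded modules, `(M ⊗ N)_k = ⊕_{i+j=k} M_i ⊗ N_j`. -/
noncomputable def tensorGM (M N : GradedMod R) : GradedMod R where
  carrier := TensorProduct R M.carrier N.carrier
  grading k := ⨆ i : ℤ, Submodule.map₂ (TensorProduct.mk R M.carrier N.carrier)
      (M.grading i) (N.grading (k - i))

/-- Dual of a graded module: a functional has degree `-i` if it kills all `M_j`, `j ≠ i`. -/
def dualGM (M : GradedMod R) : GradedMod R where
  carrier := Module.Dual R M.carrier
  grading j := ⨅ (i : ℤ) (_ : i ≠ -j), (M.grading i).dualAnnihilator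

end GradedMod

variable {R : Type u} [CommRing R]

/-- Iterated composition of a linear endomorphism. -/
def lpow {M : Type u} [AddCommGroup M] [Module R M] (f : M →ₗ[R] M) : ℕ → (M →ₗ[R] M)
  | 0 => LinearMap.id
  | n + 1 => f ∘ₗ lpow f n

section ProdHelpers

variable {A B C D E : Type u} [AddCommGroup A] [Module R A] [AddCommGroup B] [Module R B]
  [AddCommGroup C] [Module R C] [AddCommGroup D] [Module R D] [AddCommGroup E] [Module R E]

def pj₁ : (A × B × C) →ₗ[R] A := LinearMap.fst R A (B × C)
def pj₂ : (A × B × C) →ₗ[R] B := (LinearMap.fst R B C) ∘ₗ (LinearMap.snd R A (B × C))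
def pj₃ : (A × B × C) →ₗ[R] C := (LinearMap.snd R B C) ∘ₗ (LinearMap.snd R A (B × C))

def tri (f : D →ₗ[R] A) (g : D →ₗ[R] B) (h : D →ₗ[R] C) : D →ₗ[R] A × B × C :=
  f.prod (g.prod h)

def qj₁ : (A × B × C × D) →ₗ[R] A := LinearMap.fst R A (B × C × D)
def qj₂ : (A × B × C × D) →ₗ[R] B := (LinearMap.fst R B (C × D)) ∘ₗ (LinearMap.snd R A (B × C × D))
def qj₃ : (A × B × C × D) →ₗ[R] C :=
  (LinearMap.fst R C D) ∘ₗ (LinearMap.snd R B (C × D)) ∘ₗ (LinearMap.snd R A (B × C × D))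
def qj₄ : (A × B × C × D) →ₗ[R] D :=
  (LinearMap.snd R C D) ∘ₗ (LinearMap.snd R B (C × D)) ∘ₗ (LinearMap.snd R A (B × C × D))

def quad (f : E →ₗ[R] A) (g : E →ₗ[R] B) (h : E →ₗ[R] C) (l : E →ₗ[R] D) :
    E →ₗ[R] A × B × C × D := f.prod (g.prod (h.prod l))

end ProdHelpers

/-- The data of an `S`-complex over `R`: graded modules `C` (irreducible summand) and
`𝖱` (reducible summand), together with the component maps of the differential
`d~ = [[d, 0, 0], [v, −d, δ₂], [δ₁, 0, r]]` with respect to `C~ = C ⊕ C[-1] ⊕ 𝖱`. -/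
structure SCData (R : Type u) [CommRing R] : Type (u + 1) where
  Irr : GradedMod R
  Red : GradedMod R
  d : Irr.carrier →ₗ[R] Irr.carrier
  v : Irr.carrier →ₗ[R] Irr.carrier
  δ₁ : Irr.carrier →ₗ[R] Red.carrier
  δ₂ : Red.carrier →ₗ[R] Irr.carrier
  r : Red.carrier →ₗ[R] Red.carrier

namespace SCData

/-- The five relations equivalent to `d~ ∘ d~ = 0`. -/
def Relations (S : SCData R) : Prop :=
  S.d ∘ₗ S.d = 0 ∧
  S.δ₁ ∘ₗ S.d + S.r ∘ₗ S.δ₁ = 0 ∧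
  S.d ∘ₗ S.δ₂ - S.δ₂ ∘ₗ S.r = 0 ∧
  S.d ∘ₗ S.v - S.v ∘ₗ S.d - S.δ₂ ∘ₗ S.δ₁ = 0 ∧
  S.r ∘ₗ S.r = 0

/-- The degree conditions making `d~` a degree `−1` map on `C~ = C ⊕ C[-1] ⊕ 𝖱`. -/
def Degrees (S : SCData R) : Prop :=
  S.Irr.IsDeg S.Irr (-1) S.d ∧ S.Irr.IsDeg S.Irr (-2) S.v ∧
  S.Irr.IsDeg S.Red (-1) S.δ₁ ∧ S.Red.IsDeg S.Irr (-2) S.δ₂ ∧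
  S.Red.IsDeg S.Red (-1) S.r

/-- `S` is an `S`-complex. -/
def IsSComplex (S : SCData R) : Prop :=
  S.Irr.IsFGFree ∧ S.Red.IsFGFree ∧ S.Degrees ∧ S.Relations

/-- `S` is `r`-perfect: the reducible summand is concentrated in even degrees
(which forces `r = 0` and `δ₁ ∘ v^i ∘ δ₂ = 0` for all `i ≥ 0`). -/
def RPerfect (S : SCData R) : Prop :=
  (∀ j : ℤ, Odd j → S.Red.grading j = ⊥) ∧ S.r = 0 ∧
    ∀ i : ℕ, S.δ₁ ∘ₗ lpow S.v i ∘ₗ S.δ₂ = 0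

/-- The total graded module `C~ = C ⊕ C[-1] ⊕ 𝖱`. -/
def Tot (S : SCData R) : GradedMod R where
  carrier := S.Irr.carrier × S.Irr.carrier × S.Red.carrier
  grading j := (S.Irr.grading j).prod ((S.Irr.grading (j - 1)).prod (S.Red.grading j))

/-- The total differential `d~(c, c', ρ) = (d c, v c − d c' + δ₂ ρ, δ₁ c + r ρ)`. -/
def totalDiff (S : SCData R) : S.Tot.carrier →ₗ[R] S.Tot.carrier :=
  tri (S.d ∘ₗ pj₁) (S.v ∘ₗ pj₁ - S.d ∘ₗ pj₂ + S.δ₂ ∘ₗ pj₃) (S.δ₁ ∘ₗ pj₁ + S.r ∘ₗ pj₃)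

/-- The map `χ(c, c', ρ) = (0, c, 0)`. -/
def totalChi (S : SCData R) : S.Tot.carrier →ₗ[R] S.Tot.carrier :=
  tri 0 pj₁ 0

/-- The suspension `ΣC~`: `C_Σ = C[-2] ⊕ 𝖱[-1]`, `𝖱_Σ = 𝖱`, with the differential of
Definition 2.9 of the paper. -/
def susp (S : SCData R) : SCData R where
  Irr := { carrier := S.Irr.carrier × S.Red.carrier
           grading := fun j => (S.Irr.grading (j - 2)).prod (S.Red.grading (j - 1)) }
  Red := S.Red
  d := LinearMap.prod
      (S.d ∘ₗ LinearMap.fst R S.Irr.carrier S.Red.carrier -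
        S.δ₂ ∘ₗ LinearMap.snd R S.Irr.carrier S.Red.carrier)
      (-(S.r ∘ₗ LinearMap.snd R S.Irr.carrier S.Red.carrier))
  v := LinearMap.prod (S.v ∘ₗ LinearMap.fst R S.Irr.carrier S.Red.carrier)
      (S.δ₁ ∘ₗ LinearMap.fst R S.Irr.carrier S.Red.carrier)
  δ₁ := LinearMap.snd R S.Irr.carrier S.Red.carrier
  δ₂ := LinearMap.prod (S.v ∘ₗ S.δ₂) (S.δ₁ ∘ₗ S.δ₂)
  r := S.r

/-- The negative suspension `Σ⁻¹C~`: `C_{Σ⁻¹} = C[2] ⊕ 𝖱[2]`, `𝖱_{Σ⁻¹} = 𝖱`. -/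
def negSusp (S : SCData R) : SCData R where
  Irr := { carrier := S.Irr.carrier × S.Red.carrier
           grading := fun j => (S.Irr.grading (j + 2)).prod (S.Red.grading (j + 2)) }
  Red := S.Red
  d := LinearMap.prod (S.d ∘ₗ LinearMap.fst R S.Irr.carrier S.Red.carrier)
      (S.δ₁ ∘ₗ LinearMap.fst R S.Irr.carrier S.Red.carrier +
        S.r ∘ₗ LinearMap.snd R S.Irr.carrier S.Red.carrier)
  v := LinearMap.prod (S.v ∘ₗ LinearMap.fst R S.Irr.carrier S.Red.carrier +
        S.δ₂ ∘ₗ LinearMap.snd R S.Irr.carrier S.Red.carrier) 0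
  δ₁ := S.δ₁ ∘ₗ S.v ∘ₗ LinearMap.fst R S.Irr.carrier S.Red.carrier +
        S.δ₁ ∘ₗ S.δ₂ ∘ₗ LinearMap.snd R S.Irr.carrier S.Red.carrier
  δ₂ := LinearMap.prod 0 LinearMap.id
  r := S.r

/-- `Σ^n`, the `n`-fold (negative) suspension. -/
def suspPow (S : SCData R) : ℤ → SCData R
  | Int.ofNat n => (fun X : SCData R => X.susp)^[n] S
  | Int.negSucc n => (fun X : SCData R => X.negSusp)^[n + 1] S

/-- The shifted `S`-complex `C~[n]`: gradings shifted, same differential and `χ`-map. -/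
def shiftSC (S : SCData R) (n : ℤ) : SCData R where
  Irr := S.Irr.shift n
  Red := S.Red.shift n
  d := S.d
  v := S.v
  δ₁ := S.δ₁
  δ₂ := S.δ₂
  r := S.r

end SCData

/-- A map of `S`-complexes in block form `[[λ, 0, 0], [μ, λ, Δ₂], [Δ₁, 0, ρ]]`
(equivalently, a `χ`-equivariant map `C~ → C~'`); used both for morphisms and
(with appropriate signs in the total interpretation) for homotopies. -/
structure SMap {R : Type u} [CommRing R] (S T : SCData R) : Type u where
  lam : S.Irr.carrier →ₗ[R] T.Irr.carrier
  mu : S.Irr.carrier →ₗ[R] T.Irr.carrier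
  del1 : S.Irr.carrier →ₗ[R] T.Red.carrier
  del2 : S.Red.carrier →ₗ[R] T.Irr.carrier
  rho : S.Red.carrier →ₗ[R] T.Red.carrier

namespace SMap

variable {S T U : SCData R}

/-- The component relations equivalent to `d~' λ~ = λ~ d~`. -/
def IsMor (f : SMap S T) : Prop :=
  T.d ∘ₗ f.lam - f.lam ∘ₗ S.d = 0 ∧
  f.del1 ∘ₗ S.d + f.rho ∘ₗ S.δ₁ - T.δ₁ ∘ₗ f.lam - T.r ∘ₗ f.del1 = 0 ∧
  T.d ∘ₗ f.del2 - T.δ₂ ∘ₗ f.rho + f.lam ∘ₗ S.δ₂ + f.del2 ∘ₗ S.r = 0 ∧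
  f.mu ∘ₗ S.d + T.d ∘ₗ f.mu + f.lam ∘ₗ S.v - T.v ∘ₗ f.lam + f.del2 ∘ₗ S.δ₁ - T.δ₂ ∘ₗ f.del1 = 0 ∧
  f.rho ∘ₗ S.r - T.r ∘ₗ f.rho = 0

/-- The components have the degrees of a degree `k` map of `S`-complexes. -/
def DegreesAt (f : SMap S T) (k : ℤ) : Prop :=
  S.Irr.IsDeg T.Irr k f.lam ∧ S.Irr.IsDeg T.Irr (k - 1) f.mu ∧
  S.Irr.IsDeg T.Red k f.del1 ∧ S.Red.IsDeg T.Irr (k - 1) f.del2 ∧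
  S.Red.IsDeg T.Red k f.rho

/-- Composition of morphisms of `S`-complexes, componentwise. -/
def comp (g : SMap T U) (f : SMap S T) : SMap S U where
  lam := g.lam ∘ₗ f.lam
  mu := g.lam ∘ₗ f.mu + g.mu ∘ₗ f.lam + g.del2 ∘ₗ f.del1
  del1 := g.del1 ∘ₗ f.lam + g.rho ∘ₗ f.del1
  del2 := g.lam ∘ₗ f.del2 + g.del2 ∘ₗ f.rho
  rho := g.rho ∘ₗ f.rho

/-- `K` is an `S`-chain homotopy from `f` to `g`, i.e. `d~' K~ + K~ d~ = λ~ - λ~'` where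
`K~ = [[K, 0, 0], [L, -K, M₂], [M₁, 0, J]]`, in component form. -/
def IsHtpyFrom (K f g : SMap S T) : Prop :=
  T.d ∘ₗ K.lam + K.lam ∘ₗ S.d - f.lam + g.lam = 0 ∧
  T.δ₁ ∘ₗ K.lam + T.r ∘ₗ K.del1 + K.del1 ∘ₗ S.d + K.rho ∘ₗ S.δ₁ - f.del1 + g.del1 = 0 ∧
  -(T.d ∘ₗ K.del2) + T.δ₂ ∘ₗ K.rho - K.lam ∘ₗ S.δ₂ + K.del2 ∘ₗ S.r - f.del2 + g.del2 = 0 ∧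
  T.v ∘ₗ K.lam - T.d ∘ₗ K.mu + T.δ₂ ∘ₗ K.del1 + K.mu ∘ₗ S.d - K.lam ∘ₗ S.v + K.del2 ∘ₗ S.δ₁
    - f.mu + g.mu = 0 ∧
  T.r ∘ₗ K.rho + K.rho ∘ₗ S.r - f.rho + g.rho = 0

end SMap

/-- The identity morphism. -/
def idMap (S : SCData R) : SMap S S where
  lam := LinearMap.id
  mu := 0
  del1 := 0
  del2 := 0
  rho := LinearMap.id

/-- The total map `C~ → C~'` of a morphism in block form. -/
def morTotal {S T : SCData R} (f : SMap S T) : S.Tot.carrier →ₗ[R] T.Tot.carrier :=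
  tri (f.lam ∘ₗ pj₁) (f.mu ∘ₗ pj₁ + f.lam ∘ₗ pj₂ + f.del2 ∘ₗ pj₃) (f.del1 ∘ₗ pj₁ + f.rho ∘ₗ pj₃)

/-- The total map `C~ → C~'` of a homotopy in block form. -/
def htpTotal {S T : SCData R} (K : SMap S T) : S.Tot.carrier →ₗ[R] T.Tot.carrier :=
  tri (K.lam ∘ₗ pj₁) (K.mu ∘ₗ pj₁ - K.lam ∘ₗ pj₂ + K.del2 ∘ₗ pj₃) (K.del1 ∘ₗ pj₁ + K.rho ∘ₗ pj₃)

/-- `S`-chain homotopy equivalence of `S`-complexes. -/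
def SHomotopyEquiv (S T : SCData R) : Prop :=
  ∃ (f : SMap S T) (g : SMap T S) (H₁ : SMap S S) (H₂ : SMap T T),
    f.IsMor ∧ f.DegreesAt 0 ∧ g.IsMor ∧ g.DegreesAt 0 ∧
    H₁.DegreesAt 1 ∧ SMap.IsHtpyFrom H₁ (g.comp f) (idMap S) ∧
    H₂.DegreesAt 1 ∧ SMap.IsHtpyFrom H₂ (f.comp g) (idMap T)

/-- Isomorphism of `S`-complexes: a (degree `0`) morphism with a two-sided inverse morphism. -/
def SIso (S T : SCData R) : Prop :=
  ∃ (f : SMap S T) (g : SMap T S), f.IsMor ∧ f.DegreesAt 0 ∧ g.IsMor ∧ g.DegreesAt 0 ∧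
    g.comp f = idMap S ∧ f.comp g = idMap T

/-- The suspension `Σλ~` of a morphism `λ~`, in block form. -/
def suspMap {S T : SCData R} (f : SMap S T) : SMap S.susp T.susp where
  lam := LinearMap.prod
      (f.lam ∘ₗ LinearMap.fst R S.Irr.carrier S.Red.carrier +
        f.del2 ∘ₗ LinearMap.snd R S.Irr.carrier S.Red.carrier)
      (f.rho ∘ₗ LinearMap.snd R S.Irr.carrier S.Red.carrier)
  mu := LinearMap.prod (f.mu ∘ₗ LinearMap.fst R S.Irr.carrier S.Red.carrier)
      (f.del1 ∘ₗ LinearMap.fst R S.Irr.carrier S.Red.carrier)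
  del1 := 0
  del2 := LinearMap.prod (f.mu ∘ₗ S.δ₂ + T.v ∘ₗ f.del2) (f.del1 ∘ₗ S.δ₂ + T.δ₁ ∘ₗ f.del2)
  rho := f.rho

/-- The suspension `ΣK~` of a homotopy `K~`, in block form. -/
def suspHtpy {S T : SCData R} (K : SMap S T) : SMap S.susp T.susp where
  lam := LinearMap.prod
      (K.lam ∘ₗ LinearMap.fst R S.Irr.carrier S.Red.carrier -
        K.del2 ∘ₗ LinearMap.snd R S.Irr.carrier S.Red.carrier)
      (-(K.rho ∘ₗ LinearMap.snd R S.Irr.carrier S.Red.carrier))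
  mu := LinearMap.prod (K.mu ∘ₗ LinearMap.fst R S.Irr.carrier S.Red.carrier)
      (K.del1 ∘ₗ LinearMap.fst R S.Irr.carrier S.Red.carrier)
  del1 := 0
  del2 := LinearMap.prod (T.v ∘ₗ K.del2 + K.mu ∘ₗ S.δ₂) (T.δ₁ ∘ₗ K.del2 + K.del1 ∘ₗ S.δ₂)
  rho := K.rho

/-- The sequence `τ_0 = ρ`, `τ_{i+1} = δ₁'v'^iΔ₂ + Δ₁v^iδ₂ + Σ_{j<i} δ₁'v'^j μ v^{i−1−j} δ₂`
attached to an (even degree) morphism between `r`-perfect `S`-complexes. -/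
def tauSMap {S T : SCData R} (f : SMap S T) : ℕ → (S.Red.carrier →ₗ[R] T.Red.carrier)
  | 0 => f.rho
  | i + 1 =>
      T.δ₁ ∘ₗ lpow T.v i ∘ₗ f.del2 + f.del1 ∘ₗ lpow S.v i ∘ₗ S.δ₂ +
        ∑ j ∈ Finset.range i, T.δ₁ ∘ₗ lpow T.v j ∘ₗ f.mu ∘ₗ lpow S.v (i - 1 - j) ∘ₗ S.δ₂

/-- Height `n` (for `n ≥ 0`): `τ_j = 0` for `0 ≤ j < n`. -/
def SMap.HasHeight {S T : SCData R} (f : SMap S T) (n : ℕ) : Prop :=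
  ∀ j : ℕ, j < n → tauSMap f j = 0

/-- Strong height `n`: height `n` and `τ_n` an isomorphism. -/
def SMap.StrongHeight {S T : SCData R} (f : SMap S T) (n : ℕ) : Prop :=
  f.HasHeight n ∧ Function.Bijective ⇑(tauSMap f n)

/-- The explicit model of the `n`-fold suspension `Σ^n C~` of an `r`-perfect `S`-complex:
`C_{Σ^n} = C[-2n] ⊕ ⊕_{i=0}^{n-1} 𝖱[-2i-1]` (the `m`-th factor of `Fin n → 𝖱` being
`𝖱[-2(n-1-m)-1]`), `𝖱_{Σ^n} = 𝖱`, with the components of the differential as in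
Subsection 2.4 of the paper. -/
def SCData.suspN (S : SCData R) (n : ℕ) : SCData R where
  Irr := { carrier := S.Irr.carrier × (Fin n → S.Red.carrier)
           grading := fun j => (S.Irr.grading (j - 2 * (n : ℤ))).prod
             (Submodule.pi Set.univ fun m : Fin n =>
               S.Red.grading (j - 2 * (((n - 1 - (m : ℕ) : ℕ)) : ℤ) - 1)) }
  Red := S.Red
  d := LinearMap.prod
      (S.d ∘ₗ LinearMap.fst R S.Irr.carrier (Fin n → S.Red.carrier) -
        ∑ m : Fin n, lpow S.v (m : ℕ) ∘ₗ S.δ₂ ∘ₗ LinearMap.proj m ∘ₗ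
          LinearMap.snd R S.Irr.carrier (Fin n → S.Red.carrier)) 0
  v := LinearMap.prod (S.v ∘ₗ LinearMap.fst R S.Irr.carrier (Fin n → S.Red.carrier))
      (LinearMap.pi fun m : Fin n =>
        if (m : ℕ) = 0 then S.δ₁ ∘ₗ LinearMap.fst R S.Irr.carrier (Fin n → S.Red.carrier)
        else LinearMap.proj (⟨(m : ℕ) - 1, lt_of_le_of_lt (Nat.sub_le _ _) m.isLt⟩ : Fin n) ∘ₗ
          LinearMap.snd R S.Irr.carrier (Fin n → S.Red.carrier))
  δ₁ := if h : 0 < n then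
      LinearMap.proj (⟨n - 1, Nat.sub_lt h Nat.one_pos⟩ : Fin n) ∘ₗ
        LinearMap.snd R S.Irr.carrier (Fin n → S.Red.carrier)
    else 0
  δ₂ := LinearMap.prod (lpow S.v n ∘ₗ S.δ₂) 0
  r := 0

/-- The natural morphism `ι~_n : C~ → Σ^n C~`, with `λ`-component `c ↦ (c, 0, …, 0)` and
`Δ₂`-component `θ ↦ (0, θ, 0, …, 0)`. -/
def iotaN (S : SCData R) (n : ℕ) : SMap S (S.suspN n) where
  lam := LinearMap.prod LinearMap.id 0
  mu := 0
  del1 := 0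
  del2 := LinearMap.prod 0 (LinearMap.pi fun m : Fin n => if (m : ℕ) = 0 then LinearMap.id else 0)
  rho := 0

/-- The data of a generalized height morphism between `r`-perfect `S`-complexes:
the four maps `λ, μ, Δ₁, Δ₂` and the sequence `τ_i` for `i ∈ ℤ`. -/
structure HMor {R : Type u} [CommRing R] (S T : SCData R) : Type u where
  lam : S.Irr.carrier →ₗ[R] T.Irr.carrier
  mu : S.Irr.carrier →ₗ[R] T.Irr.carrier
  del1 : S.Irr.carrier →ₗ[R] T.Red.carrier
  del2 : S.Red.carrier →ₗ[R] T.Irr.carrier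
  tau : ℤ → (S.Red.carrier →ₗ[R] T.Red.carrier)

/-- `f` is a height `n` morphism of (even) degree `k` between `r`-perfect `S`-complexes. -/
def HMor.IsHeightMor {S T : SCData R} (f : HMor S T) (n : ℤ) (k : ℤ) : Prop :=
  Even k ∧
  S.Irr.IsDeg T.Irr k f.lam ∧ S.Irr.IsDeg T.Irr (k - 1) f.mu ∧
  S.Irr.IsDeg T.Red k f.del1 ∧ S.Red.IsDeg T.Irr (k - 1) f.del2 ∧
  (∀ i : ℤ, S.Red.IsDeg T.Red (k - 2 * i) (f.tau i)) ∧
  (∀ i : ℤ, i < n → f.tau i = 0) ∧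
  (∀ i : ℕ, f.tau ((i : ℤ) + 1) =
      T.δ₁ ∘ₗ lpow T.v i ∘ₗ f.del2 + f.del1 ∘ₗ lpow S.v i ∘ₗ S.δ₂ +
        ∑ j ∈ Finset.range i, T.δ₁ ∘ₗ lpow T.v j ∘ₗ f.mu ∘ₗ lpow S.v (i - 1 - j) ∘ₗ S.δ₂) ∧
  (T.d ∘ₗ f.lam - f.lam ∘ₗ S.d -
      ∑ᶠ i : ℕ, ∑ j ∈ Finset.range (i + 1),
        lpow T.v j ∘ₗ T.δ₂ ∘ₗ f.tau (-((i : ℤ) + 1)) ∘ₗ S.δ₁ ∘ₗ lpow S.v (i - j) = 0) ∧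
  (-(T.δ₁ ∘ₗ f.lam) + f.del1 ∘ₗ S.d + ∑ᶠ i : ℕ, f.tau (-(i : ℤ)) ∘ₗ S.δ₁ ∘ₗ lpow S.v i = 0) ∧
  (f.lam ∘ₗ S.δ₂ + T.d ∘ₗ f.del2 - ∑ᶠ i : ℕ, lpow T.v i ∘ₗ T.δ₂ ∘ₗ f.tau (-(i : ℤ)) = 0) ∧
  (f.mu ∘ₗ S.d + T.d ∘ₗ f.mu + f.lam ∘ₗ S.v - T.v ∘ₗ f.lam + f.del2 ∘ₗ S.δ₁ - T.δ₂ ∘ₗ f.del1 = 0)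

/-- Composition of generalized height morphisms (Definition 2.23 of the paper). -/
noncomputable def HMor.compH {S T U : SCData R} (g : HMor T U) (f : HMor S T) : HMor S U where
  lam := g.lam ∘ₗ f.lam
    + (∑ᶠ i : ℕ, ∑ j ∈ Finset.range (i + 1),
        lpow U.v j ∘ₗ U.δ₂ ∘ₗ g.tau (-((i : ℤ) + 1)) ∘ₗ f.del1 ∘ₗ lpow S.v (i - j))
    + (∑ᶠ i : ℕ, ∑ j ∈ Finset.range (i + 1),
        lpow U.v j ∘ₗ g.del2 ∘ₗ f.tau (-((i : ℤ) + 1)) ∘ₗ S.δ₁ ∘ₗ lpow S.v (i - j))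
    + (∑ᶠ i : ℕ, ∑ j ∈ Finset.range (i + 1), ∑ l ∈ Finset.range (i - j + 1),
        lpow U.v j ∘ₗ U.δ₂ ∘ₗ g.tau (-((i : ℤ) + 2)) ∘ₗ T.δ₁ ∘ₗ lpow T.v l ∘ₗ f.mu ∘ₗ
          lpow S.v (i - j - l))
    + (∑ᶠ i : ℕ, ∑ j ∈ Finset.range (i + 1), ∑ l ∈ Finset.range (i - j + 1),
        lpow U.v j ∘ₗ g.mu ∘ₗ lpow T.v l ∘ₗ T.δ₂ ∘ₗ f.tau (-((i : ℤ) + 2)) ∘ₗ S.δ₁ ∘ₗ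
          lpow S.v (i - j - l))
  mu := g.lam ∘ₗ f.mu + g.mu ∘ₗ f.lam + g.del2 ∘ₗ f.del1
  del1 := g.del1 ∘ₗ f.lam + (∑ᶠ i : ℕ, g.tau (-(i : ℤ)) ∘ₗ f.del1 ∘ₗ lpow S.v i)
    + (∑ᶠ i : ℕ, ∑ j ∈ Finset.range (i + 1),
        g.tau (-((i : ℤ) + 1)) ∘ₗ T.δ₁ ∘ₗ lpow T.v j ∘ₗ f.mu ∘ₗ lpow S.v (i - j))
  del2 := g.lam ∘ₗ f.del2 + (∑ᶠ i : ℕ, lpow U.v i ∘ₗ g.del2 ∘ₗ f.tau (-(i : ℤ)))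
    + (∑ᶠ i : ℕ, ∑ j ∈ Finset.range (i + 1),
        lpow U.v j ∘ₗ g.mu ∘ₗ lpow T.v (i - j) ∘ₗ T.δ₂ ∘ₗ f.tau (-((i : ℤ) + 1)))
  tau := fun i => ∑ᶠ l : ℤ, g.tau (i - l) ∘ₗ f.tau l

/-- The strong height `−n` morphism `κ~_n : Σ^n C~ → C~`. -/
def kappaN (T : SCData R) (n : ℕ) : HMor (T.suspN n) T where
  lam := LinearMap.fst R T.Irr.carrier (Fin n → T.Red.carrier)
  mu := 0
  del1 := 0
  del2 := 0
  tau := fun i => if i = -(n : ℤ) then LinearMap.id else 0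

/-- An (even degree) morphism of `S`-complexes, regarded as a generalized height morphism. -/
def SMap.toHMor {S T : SCData R} (f : SMap S T) : HMor S T where
  lam := f.lam
  mu := f.mu
  del1 := f.del1
  del2 := f.del2
  tau := fun i => if 0 ≤ i then tauSMap f i.toNat else 0

/-- The height `0` morphism `λ~' : C~ → Σ^n C~'` associated to a height `−n` morphism
(Proposition 2.25 of the paper). -/
def heightNegToSusp {S T : SCData R} (f : HMor S T) (n : ℕ) : SMap S (T.suspN n) where
  lam := LinearMap.prod f.lam
    (LinearMap.pi fun m : Fin n =>
      ∑ i ∈ Finset.Icc ((m : ℕ) + 1) n, f.tau (-(i : ℤ)) ∘ₗ S.δ₁ ∘ₗ lpow S.v (i - 1 - (m : ℕ)))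
  mu := LinearMap.prod f.mu (LinearMap.pi fun m : Fin n => if (m : ℕ) = 0 then f.del1 else 0)
  del1 := 0
  del2 := LinearMap.prod f.del2 (LinearMap.pi fun m : Fin n => f.tau (-((m : ℕ) : ℤ)))
  rho := f.tau (-(n : ℤ))

/-- The morphism `ι~₁ : C~ → ΣC~`. -/
def iotaOne (S : SCData R) : SMap S S.susp where
  lam := LinearMap.prod LinearMap.id 0
  mu := 0
  del1 := 0
  del2 := LinearMap.prod 0 LinearMap.id
  rho := 0

/-- The morphism `λ~'' : ΣC~' → C~''` associated to an odd degree morphism `λ~'` together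
with the map `ν' : 𝖱' → 𝖱''` (Subsection 2.6 of the paper). -/
def lambdaSecond {S T : SCData R} (f : SMap S T) (nu : S.Red.carrier →ₗ[R] T.Red.carrier) :
    SMap S.susp T where
  lam := f.lam ∘ₗ LinearMap.fst R S.Irr.carrier S.Red.carrier +
    f.del2 ∘ₗ LinearMap.snd R S.Irr.carrier S.Red.carrier
  mu := f.mu ∘ₗ LinearMap.fst R S.Irr.carrier S.Red.carrier
  del1 := f.del1 ∘ₗ LinearMap.fst R S.Irr.carrier S.Red.carrier +
    nu ∘ₗ LinearMap.snd R S.Irr.carrier S.Red.carrier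
  del2 := f.mu ∘ₗ S.δ₂ + T.v ∘ₗ f.del2 + T.δ₂ ∘ₗ nu
  rho := 0

/-- The morphism `λ~₁ : C~ → ΣC~'` associated to height `−1` morphism data
`(λ, μ, Δ₁, Δ₂, τ₀, τ₋₁)`, in block form
`[[λ, 0, 0], [τ₋₁δ₁, 0, 0], [μ, λ, Δ₂], [Δ₁, τ₋₁δ₁, τ₀], [0, 0, τ₋₁]]`. -/
def hNegOneSusp {S T : SCData R} (lam0 mu0 : S.Irr.carrier →ₗ[R] T.Irr.carrier)
    (del10 : S.Irr.carrier →ₗ[R] T.Red.carrier) (del20 : S.Red.carrier →ₗ[R] T.Irr.carrier)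
    (tau0 taum1 : S.Red.carrier →ₗ[R] T.Red.carrier) : SMap S T.susp where
  lam := LinearMap.prod lam0 (taum1 ∘ₗ S.δ₁)
  mu := LinearMap.prod mu0 del10
  del1 := 0
  del2 := LinearMap.prod del20 tau0
  rho := taum1

/-- The mapping cone of a degree `k` morphism `λ~ : C~ → C~'`, as an `S`-complex;
its underlying graded module is `C~[-1-k] ⊕ C~'`. -/
def coneSC {S T : SCData R} (f : SMap S T) (k : ℤ) : SCData R where
  Irr := { carrier := S.Irr.carrier × T.Irr.carrier
           grading := fun j => (S.Irr.grading (j - 1 - k)).prod (T.Irr.grading j) }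
  Red := { carrier := S.Red.carrier × T.Red.carrier
           grading := fun j => (S.Red.grading (j - 1 - k)).prod (T.Red.grading j) }
  d := LinearMap.prod (-(S.d ∘ₗ LinearMap.fst R S.Irr.carrier T.Irr.carrier))
      (f.lam ∘ₗ LinearMap.fst R S.Irr.carrier T.Irr.carrier +
        T.d ∘ₗ LinearMap.snd R S.Irr.carrier T.Irr.carrier)
  v := LinearMap.prod (S.v ∘ₗ LinearMap.fst R S.Irr.carrier T.Irr.carrier)
      (f.mu ∘ₗ LinearMap.fst R S.Irr.carrier T.Irr.carrier +
        T.v ∘ₗ LinearMap.snd R S.Irr.carrier T.Irr.carrier)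
  δ₁ := LinearMap.prod (-(S.δ₁ ∘ₗ LinearMap.fst R S.Irr.carrier T.Irr.carrier))
      (f.del1 ∘ₗ LinearMap.fst R S.Irr.carrier T.Irr.carrier +
        T.δ₁ ∘ₗ LinearMap.snd R S.Irr.carrier T.Irr.carrier)
  δ₂ := LinearMap.prod (S.δ₂ ∘ₗ LinearMap.fst R S.Red.carrier T.Red.carrier)
      (f.del2 ∘ₗ LinearMap.fst R S.Red.carrier T.Red.carrier +
        T.δ₂ ∘ₗ LinearMap.snd R S.Red.carrier T.Red.carrier)
  r := LinearMap.prod (-(S.r ∘ₗ LinearMap.fst R S.Red.carrier T.Red.carrier))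
      (f.rho ∘ₗ LinearMap.fst R S.Red.carrier T.Red.carrier +
        T.r ∘ₗ LinearMap.snd R S.Red.carrier T.Red.carrier)

/-- Direct sum of `S`-complexes. -/
def sumSC (S T : SCData R) : SCData R where
  Irr := S.Irr.prodGM T.Irr
  Red := S.Red.prodGM T.Red
  d := S.d.prodMap T.d
  v := S.v.prodMap T.v
  δ₁ := S.δ₁.prodMap T.δ₁
  δ₂ := S.δ₂.prodMap T.δ₂
  r := S.r.prodMap T.r

/-- The dual `S`-complex `C~†`, defined using sign operators on the dual graded modules:
`m†(f) = −ε(f) f ∘ m`, with the roles of `δ₁` and `δ₂` interchanged. -/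
def dualSC (S : SCData R)
    (eCd : Module.Dual R S.Irr.carrier →ₗ[R] Module.Dual R S.Irr.carrier)
    (eRd : Module.Dual R S.Red.carrier →ₗ[R] Module.Dual R S.Red.carrier) : SCData R where
  Irr := S.Irr.dualGM
  Red := S.Red.dualGM
  d := -(S.d.dualMap ∘ₗ eCd)
  v := -(S.v.dualMap ∘ₗ eCd)
  δ₁ := -(S.δ₂.dualMap ∘ₗ eCd)
  δ₂ := -(S.δ₁.dualMap ∘ₗ eRd)
  r := -(S.r.dualMap ∘ₗ eRd)

/-- The rank-one graded module `R`, concentrated in degree `n`. -/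
def unitGM (R : Type u) [CommRing R] (n : ℤ) : GradedMod R where
  carrier := R
  grading j := if j = n then ⊤ else ⊥

/-- The `S`-complex `O~(1)`: `C = R` in degree `1`, `𝖱 = R` in degree `0`, `δ₁ = id`. -/
def O1 (R : Type u) [CommRing R] : SCData R where
  Irr := unitGM R 1
  Red := unitGM R 0
  d := 0
  v := 0
  δ₁ := LinearMap.id
  δ₂ := 0
  r := 0

/-- The `S`-complex `O~(-1)`: `C = R` in degree `-2`, `𝖱 = R` in degree `0`, `δ₂ = id`. -/
def Om1 (R : Type u) [CommRing R] : SCData R where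
  Irr := unitGM R (-2)
  Red := unitGM R 0
  d := 0
  v := 0
  δ₁ := 0
  δ₂ := LinearMap.id
  r := 0

/-- The `S`-complex `O~(0)`: `C = 0`, `𝖱 = R` in degree `0`, zero differential. -/
def O0 (R : Type u) [CommRing R] : SCData R where
  Irr := { carrier := ↥(⊥ : Submodule R R), grading := fun _ => ⊥ }
  Red := unitGM R 0
  d := 0
  v := 0
  δ₁ := 0
  δ₂ := 0
  r := 0

/-- The `S`-complex representation of the tensor product `C~ ⊗ C~'` of `S`-complexes
(Subsection 2.2 of the paper), where `eC`, `eR` are the sign operators of the first factor: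
`C^⊗ = (C⊗C') ⊕ (C⊗C')[-1] ⊕ (C⊗𝖱') ⊕ (𝖱⊗C')` and `𝖱^⊗ = 𝖱⊗𝖱'`. -/
noncomputable def tensorRep (S T : SCData R)
    (eC : S.Irr.carrier →ₗ[R] S.Irr.carrier) (eR : S.Red.carrier →ₗ[R] S.Red.carrier) :
    SCData R where
  Irr := (S.Irr.tensorGM T.Irr).prodGM (((S.Irr.tensorGM T.Irr).shift (-1)).prodGM
      ((S.Irr.tensorGM T.Red).prodGM (S.Red.tensorGM T.Irr)))
  Red := S.Red.tensorGM T.Red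
  d := quad
      (TensorProduct.map S.d LinearMap.id ∘ₗ qj₁ + TensorProduct.map eC T.d ∘ₗ qj₁)
      (TensorProduct.map (-(eC ∘ₗ S.v)) LinearMap.id ∘ₗ qj₁ + TensorProduct.map eC T.v ∘ₗ qj₁
        + TensorProduct.map S.d LinearMap.id ∘ₗ qj₂ - TensorProduct.map eC T.d ∘ₗ qj₂
        + TensorProduct.map eC T.δ₂ ∘ₗ qj₃
        + TensorProduct.map (-(eC ∘ₗ S.δ₂)) LinearMap.id ∘ₗ qj₄)
      (TensorProduct.map eC T.δ₁ ∘ₗ qj₁ + TensorProduct.map S.d LinearMap.id ∘ₗ qj₃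
        + TensorProduct.map eC T.r ∘ₗ qj₃)
      (TensorProduct.map S.δ₁ LinearMap.id ∘ₗ qj₁ + TensorProduct.map eR T.d ∘ₗ qj₄
        + TensorProduct.map S.r LinearMap.id ∘ₗ qj₄)
  v := quad
      (TensorProduct.map S.v LinearMap.id ∘ₗ qj₁ + TensorProduct.map S.δ₂ LinearMap.id ∘ₗ qj₄)
      (TensorProduct.map S.v LinearMap.id ∘ₗ qj₂)
      (TensorProduct.map S.v LinearMap.id ∘ₗ qj₃)
      (TensorProduct.map (eR ∘ₗ S.δ₁) LinearMap.id ∘ₗ qj₂ + TensorProduct.map LinearMap.id T.v ∘ₗ qj₄)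
  δ₁ := TensorProduct.map S.δ₁ LinearMap.id ∘ₗ qj₃ + TensorProduct.map eR T.δ₁ ∘ₗ qj₄
  δ₂ := quad 0 0 (TensorProduct.map S.δ₂ LinearMap.id) (TensorProduct.map LinearMap.id T.δ₂)
  r := TensorProduct.map S.r LinearMap.id + TensorProduct.map eR T.r

/-- Homology of an endomorphism (thought of as a differential): `ker D / im D`. -/
abbrev homologyOf {M : Type u} [AddCommGroup M] [Module R M] (D : M →ₗ[R] M) : Type u :=
  ↥(LinearMap.ker D) ⧸
    Submodule.comap (LinearMap.ker D).subtype (LinearMap.range D)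

/-- The map induced on homology by a chain map. -/
def inducedMap {M N : Type u} [AddCommGroup M] [Module R M] [AddCommGroup N] [Module R N]
    (DM : M →ₗ[R] M) (DN : N →ₗ[R] N) (f : M →ₗ[R] N) (h : DN ∘ₗ f = f ∘ₗ DM) :
    homologyOf DM →ₗ[R] homologyOf DN :=
  Submodule.mapQ _ _
    (f.restrict (p := LinearMap.ker DM) (q := LinearMap.ker DN) (fun x hx => by
      have h1 : DN (f x) = f (DM x) := by
        have h2 := LinearMap.congr_fun h x
        simpa using h2
      have hx0 : DM x = 0 := LinearMap.mem_ker.mp hx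
      simp [LinearMap.mem_ker, h1, hx0]))
    (by
      intro x hx
      simp only [Submodule.mem_comap] at hx ⊢
      obtain ⟨y, hy⟩ := hx
      refine ⟨f y, ?_⟩
      have h1 : DN (f y) = f (DM y) := by
        have h2 := LinearMap.congr_fun h y
        simpa using h2
      simp only [Submodule.coe_subtype] at hy ⊢
      rw [LinearMap.restrict_apply]
      rw [h1, hy])

/-- The degree `j` homology of a graded module with a (degree `-1`) differential. -/
abbrev gradedHomology (M : GradedMod R) (D : M.carrier →ₗ[R] M.carrier) (j : ℤ) : Type u :=
  ↥(M.grading j ⊓ LinearMap.ker D) ⧸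
    Submodule.comap (M.grading j ⊓ LinearMap.ker D).subtype ((M.grading (j + 1)).map D)

/-- The Euler characteristic `Σ_j (-1)^j rk_R M_j` of a graded module. -/
noncomputable def eulerChar (M : GradedMod R) : ℤ :=
  ∑ᶠ j : ℤ, (if Even j then (1 : ℤ) else -1) * (Module.finrank R ↥(M.grading j) : ℤ)

/-- The small equivariant complex `Ĉ = C[-1] ⊕ 𝖱[x]`, with `𝖱[x]` modelled as `ℕ →₀ 𝖱`. -/
abbrev hatC (S : SCData R) : Type u := S.Irr.carrier × (ℕ →₀ S.Red.carrier)

/-- The differential `𝔡̂(α, θxⁱ) = (dα − vⁱδ₂θ, 0)`. -/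
noncomputable def hatD (S : SCData R) : hatC S →ₗ[R] hatC S :=
  LinearMap.prod
    (S.d ∘ₗ LinearMap.fst R S.Irr.carrier (ℕ →₀ S.Red.carrier) -
      (Finsupp.lsum ℕ fun i : ℕ => lpow S.v i ∘ₗ S.δ₂) ∘ₗ
        LinearMap.snd R S.Irr.carrier (ℕ →₀ S.Red.carrier))
    0

/-- The `x`-action `x·(α, θxⁱ) = (vα, δ₁α + θx^{i+1})` on `Ĉ`. -/
noncomputable def hatX (S : SCData R) : hatC S →ₗ[R] hatC S :=
  LinearMap.prod (S.v ∘ₗ LinearMap.fst R S.Irr.carrier (ℕ →₀ S.Red.carrier))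
    (Finsupp.lsingle 0 ∘ₗ S.δ₁ ∘ₗ LinearMap.fst R S.Irr.carrier (ℕ →₀ S.Red.carrier) +
      Finsupp.lmapDomain S.Red.carrier R (fun i => i + 1) ∘ₗ
        LinearMap.snd R S.Irr.carrier (ℕ →₀ S.Red.carrier))

/-- The small equivariant complex `Č = C ⊕ 𝖱[[x⁻¹,x]/𝖱[x]`, the tail modelled as `ℕ → 𝖱`
(the `m`-th coordinate is the coefficient of `x^{-m-1}`). -/
abbrev checkC (S : SCData R) : Type u := S.Irr.carrier × (ℕ → S.Red.carrier)

/-- The differential `𝔡̌(α, θxⁱ) = (dα, Σ_{j≤-1} δ₁v^{−j−1}(α)xʲ)`. -/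
noncomputable def checkD (S : SCData R) : checkC S →ₗ[R] checkC S :=
  LinearMap.prod (S.d ∘ₗ LinearMap.fst R S.Irr.carrier (ℕ → S.Red.carrier))
    (LinearMap.pi fun m : ℕ =>
      S.δ₁ ∘ₗ lpow S.v m ∘ₗ LinearMap.fst R S.Irr.carrier (ℕ → S.Red.carrier))

/-- The `x`-action on `Č`. -/
noncomputable def checkX (S : SCData R) : checkC S →ₗ[R] checkC S :=
  LinearMap.prod
    (S.v ∘ₗ LinearMap.fst R S.Irr.carrier (ℕ → S.Red.carrier) +
      S.δ₂ ∘ₗ LinearMap.proj 0 ∘ₗ LinearMap.snd R S.Irr.carrier (ℕ → S.Red.carrier))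
    (LinearMap.pi fun m : ℕ =>
      LinearMap.proj (m + 1) ∘ₗ LinearMap.snd R S.Irr.carrier (ℕ → S.Red.carrier))

/-- The module `𝖱[[x⁻¹,x]` of Laurent series with finitely many positive powers, modelled
as (polynomial part, tail): `(ℕ →₀ 𝖱) × (ℕ → 𝖱)`. -/
abbrev barC (S : SCData R) : Type u := (ℕ →₀ S.Red.carrier) × (ℕ → S.Red.carrier)

/-- Multiplication by `x` on `𝖱[[x⁻¹,x]`. -/
noncomputable def barX (S : SCData R) : barC S →ₗ[R] barC S :=
  LinearMap.prod
    (Finsupp.lsingle 0 ∘ₗ LinearMap.proj 0 ∘ₗ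
        LinearMap.snd R (ℕ →₀ S.Red.carrier) (ℕ → S.Red.carrier) +
      Finsupp.lmapDomain S.Red.carrier R (fun i => i + 1) ∘ₗ
        LinearMap.fst R (ℕ →₀ S.Red.carrier) (ℕ → S.Red.carrier))
    (LinearMap.pi fun m : ℕ =>
      LinearMap.proj (m + 1) ∘ₗ LinearMap.snd R (ℕ →₀ S.Red.carrier) (ℕ → S.Red.carrier))

/-- The chain map `𝔦 : Ĉ → 𝖱[[x⁻¹,x]`, `(α, θ) ↦ Σ_{i≤-1} δ₁v^{−i−1}(α)xⁱ + θ`. -/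
noncomputable def mapI (S : SCData R) : hatC S →ₗ[R] barC S :=
  LinearMap.prod (LinearMap.snd R S.Irr.carrier (ℕ →₀ S.Red.carrier))
    (LinearMap.pi fun m : ℕ =>
      S.δ₁ ∘ₗ lpow S.v m ∘ₗ LinearMap.fst R S.Irr.carrier (ℕ →₀ S.Red.carrier))

/-- The chain map `𝔧 : Č → Ĉ`, `(α, ·) ↦ (−α, 0)`. -/
noncomputable def mapJ (S : SCData R) : checkC S →ₗ[R] hatC S :=
  LinearMap.prod (-(LinearMap.fst R S.Irr.carrier (ℕ → S.Red.carrier))) 0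

/-- The chain map `𝔭 : 𝖱[[x⁻¹,x] → Č`, `Σθᵢxⁱ ↦ (Σ_{i≥0} vⁱδ₂θᵢ, Σ_{i≤-1} θᵢxⁱ)`. -/
noncomputable def mapP (S : SCData R) : barC S →ₗ[R] checkC S :=
  LinearMap.prod
    ((Finsupp.lsum ℕ fun i : ℕ => lpow S.v i ∘ₗ S.δ₂) ∘ₗ
      LinearMap.fst R (ℕ →₀ S.Red.carrier) (ℕ → S.Red.carrier))
    (LinearMap.snd R (ℕ →₀ S.Red.carrier) (ℕ → S.Red.carrier))

/-- The coefficient of `xᵉ`, as a linear map `𝖱[[x⁻¹,x] → 𝖱`. -/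
noncomputable def coeffLM (S : SCData R) (e : ℤ) : barC S →ₗ[R] S.Red.carrier :=
  if 0 ≤ e then
    Finsupp.lapply e.toNat ∘ₗ LinearMap.fst R (ℕ →₀ S.Red.carrier) (ℕ → S.Red.carrier)
  else
    LinearMap.proj (-e - 1).toNat ∘ₗ LinearMap.snd R (ℕ →₀ S.Red.carrier) (ℕ → S.Red.carrier)

/-- `𝔍(C~) ⊆ 𝖱[[x⁻¹,x]`, the image of `i⋆ : Ĥ → 𝖱[[x⁻¹,x]` (equal to `𝔦(ker 𝔡̂)`). -/
noncomputable def Jmod (S : SCData R) : Submodule R (barC S) :=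
  (LinearMap.ker (hatD S)).map (mapI S)

/-- `J_i(C~) = { a₀ ∈ 𝖱 | ∃ a₀x^{-i} + a₋₁x^{-i-1} + ⋯ ∈ 𝔍(C~) }`. -/
noncomputable def Jset (S : SCData R) (i : ℤ) : Submodule R S.Red.carrier :=
  ((Jmod S) ⊓ ⨅ (e : ℤ) (_ : -i < e), LinearMap.ker (coeffLM S e)).map (coeffLM S (-i))

/-- The function `d_{C~}(i) = rk_R J_i(C~)`. -/
noncomputable def dFun (S : SCData R) (i : ℤ) : ℕ := Module.finrank R ↥(Jset S i)

open scoped TensorProduct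

namespace GradedMod


/-- Linear maps agreeing on every homogeneous piece of an internally graded module are equal. -/
theorem IsFGFree.linearMap_ext {M : GradedMod R} (hM : M.IsFGFree) {N : Type*} [AddCommGroup N]
    [Module R N] {f g : M.carrier →ₗ[R] N} (h : ∀ i, ∀ x ∈ M.grading i, f x = g x) : f = g := by
  have hle : (⨆ i, M.grading i) ≤ LinearMap.eqLocus f g := iSup_le fun i x hx => h i x hx
  rw [hM.1.submodule_iSup_eq_top] at hle
  exact LinearMap.ext fun x => hle (Submodule.mem_top : x ∈ ⊤)

theorem IsSign.comp_self {M : GradedMod R} (hM : M.IsFGFree) {e : M.carrier →ₗ[R] M.carrier}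
    (he : M.IsSign e) (x : M.carrier) : e (e x) = x := by
  refine LinearMap.congr_fun (f := e ∘ₗ e) (g := LinearMap.id) (hM.linearMap_ext fun i x hx => ?_) x
  by_cases hi : Even i <;> simp [he i x hx, hi]

theorem IsSign.mem_grading {M : GradedMod R} {e : M.carrier →ₗ[R] M.carrier}
    (he : M.IsSign e) {i : ℤ} {x : M.carrier} (hx : x ∈ M.grading i) : e x ∈ M.grading i := by
  rw [he i x hx]
  split_ifs
  · exact hx
  · exact neg_mem hx

theorem isDeg_zero {M N : GradedMod R} {k : ℤ} : M.IsDeg N k 0 := fun i => by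
  rw [Submodule.map_zero]
  exact bot_le

/-- The sign operators commute with maps of even degree. -/
theorem IsSign.apply_of_even {M N : GradedMod R} (hM : M.IsFGFree)
    {e : M.carrier →ₗ[R] M.carrier} {e' : N.carrier →ₗ[R] N.carrier} (he : M.IsSign e)
    (he' : N.IsSign e') {k : ℤ} (hk : Even k) {f : M.carrier →ₗ[R] N.carrier}
    (hf : M.IsDeg N k f) (x : M.carrier) : e' (f x) = f (e x) := by
  refine LinearMap.congr_fun (f := e' ∘ₗ f) (g := f ∘ₗ e) (hM.linearMap_ext fun i x hx => ?_) x
  have hfx := he' (i + k) (f x) (hf i ⟨x, hx, rfl⟩)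
  by_cases hi : Even i <;> simp [he i x hx, hfx, Int.even_add, hk, hi]

/-- The sign operators anticommute with maps of odd degree. -/
theorem IsSign.apply_of_odd {M N : GradedMod R} (hM : M.IsFGFree)
    {e : M.carrier →ₗ[R] M.carrier} {e' : N.carrier →ₗ[R] N.carrier} (he : M.IsSign e)
    (he' : N.IsSign e') {k : ℤ} (hk : Odd k) {f : M.carrier →ₗ[R] N.carrier}
    (hf : M.IsDeg N k f) (x : M.carrier) : e' (f x) = -f (e x) := by
  refine LinearMap.congr_fun (f := e' ∘ₗ f) (g := -(f ∘ₗ e)) (hM.linearMap_ext fun i x hx => ?_) x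
  have hfx := he' (i + k) (f x) (hf i ⟨x, hx, rfl⟩)
  by_cases hi : Even i <;>
    simp [he i x hx, hfx, Int.even_add, Int.not_even_iff_odd.mpr hk, hi]

/-- `M` identified with its tensor product with the rank-one module in degree `n`. -/
noncomputable def tensorUnit (M : GradedMod R) (n : ℤ) :
    M.carrier ≃ₗ[R] (M.tensorGM (unitGM R n)).carrier :=
  (TensorProduct.rid R M.carrier).symm

theorem tensorUnit_mem_grading {M : GradedMod R} {n i k : ℤ} (h : i + n = k)
    {x : M.carrier} (hx : x ∈ M.grading i) :
    M.tensorUnit n x ∈ (M.tensorGM (unitGM R n)).grading k := by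
  have hk : k - i = n := by omega
  have h1 : (1 : R) ∈ (unitGM R n).grading (k - i) := by
    simp only [unitGM, hk, if_true]
    exact Submodule.mem_top
  exact Submodule.mem_iSup_of_mem (p := fun i => Submodule.map₂
    (TensorProduct.mk R M.carrier (unitGM R n).carrier) (M.grading i)
      ((unitGM R n).grading (k - i))) i (Submodule.apply_mem_map₂ _ hx h1)

theorem mem_grading_of_tensorUnit_mem {M : GradedMod R} {n i k : ℤ} (h : i + n = k)
    {x : M.carrier} (hx : M.tensorUnit n x ∈ (M.tensorGM (unitGM R n)).grading k) :
    x ∈ M.grading i := by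
  suffices hle : (M.tensorGM (unitGM R n)).grading k ≤
      (M.grading i).comap (M.tensorUnit n).symm.toLinearMap by
    simpa using hle hx
  refine iSup_le fun j => Submodule.map₂_le.mpr fun m hm a ha => ?_
  change R at a
  change TensorProduct.rid R M.carrier (m ⊗ₜ[R] a) ∈ M.grading i
  rw [TensorProduct.rid_tmul]
  by_cases hj : k - j = n
  · obtain rfl : j = i := by omega
    exact Submodule.smul_mem _ _ hm
  · have ha0 : a = 0 := by
      simp only [unitGM, hj, if_false] at ha
      exact (Submodule.mem_bot R).mp ha
    rw [ha0, zero_smul]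
    exact zero_mem _

theorem tensorUnit_mem_grading_iff {M : GradedMod R} {n i k : ℤ} (h : i + n = k)
    {x : M.carrier} :
    M.tensorUnit n x ∈ (M.tensorGM (unitGM R n)).grading k ↔ x ∈ M.grading i :=
  ⟨mem_grading_of_tensorUnit_mem h, tensorUnit_mem_grading h⟩

end GradedMod

namespace TensorOm1

variable (S : SCData R)
  (eC : S.Irr.carrier →ₗ[R] S.Irr.carrier) (eR : S.Red.carrier →ₗ[R] S.Red.carrier)

/-- The irreducible summand of `C~ ⊗ O~(-1)`, identified with `C ⊕ C ⊕ C ⊕ 𝖱`. -/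
noncomputable def irr : (S.Irr.carrier × S.Irr.carrier × S.Irr.carrier × S.Red.carrier) ≃ₗ[R]
    (tensorRep S (Om1 R) eC eR).Irr.carrier :=
  (S.Irr.tensorUnit (-2)).prodCongr ((S.Irr.tensorUnit (-2)).prodCongr
    ((S.Irr.tensorUnit 0).prodCongr (S.Red.tensorUnit (-2))))

/-- The reducible summand of `C~ ⊗ O~(-1)`, identified with `𝖱`. -/
noncomputable def red : S.Red.carrier ≃ₗ[R] (tensorRep S (Om1 R) eC eR).Red.carrier :=
  S.Red.tensorUnit 0

theorem d_irr (a b c : S.Irr.carrier) (θ : S.Red.carrier) :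
    (tensorRep S (Om1 R) eC eR).d (irr S eC eR (a, b, c, θ)) =
      irr S eC eR (S.d a, -eC (S.v a) + S.d b + eC c - eC (S.δ₂ θ), S.d c, S.δ₁ a + S.r θ) := by
  refine Prod.ext ?_ (Prod.ext ?_ (Prod.ext ?_ ?_))
  · change TensorProduct.map S.d LinearMap.id (a ⊗ₜ[R] (1 : R)) +
      TensorProduct.map eC (0 : R →ₗ[R] R) (a ⊗ₜ[R] (1 : R)) = S.d a ⊗ₜ[R] (1 : R)
    simp
  · change TensorProduct.map (-(eC ∘ₗ S.v)) LinearMap.id (a ⊗ₜ[R] (1 : R)) +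
        TensorProduct.map eC (0 : R →ₗ[R] R) (a ⊗ₜ[R] (1 : R)) +
        TensorProduct.map S.d LinearMap.id (b ⊗ₜ[R] (1 : R)) -
        TensorProduct.map eC (0 : R →ₗ[R] R) (b ⊗ₜ[R] (1 : R)) +
        TensorProduct.map eC LinearMap.id (c ⊗ₜ[R] (1 : R)) +
        TensorProduct.map (-(eC ∘ₗ S.δ₂)) LinearMap.id (θ ⊗ₜ[R] (1 : R)) =
      (-eC (S.v a) + S.d b + eC c - eC (S.δ₂ θ)) ⊗ₜ[R] (1 : R)
    simp [TensorProduct.add_tmul, TensorProduct.neg_tmul, sub_eq_add_neg]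
  · change TensorProduct.map eC (0 : R →ₗ[R] R) (a ⊗ₜ[R] (1 : R)) +
        TensorProduct.map S.d LinearMap.id (c ⊗ₜ[R] (1 : R)) +
        TensorProduct.map eC (0 : R →ₗ[R] R) (c ⊗ₜ[R] (1 : R)) = S.d c ⊗ₜ[R] (1 : R)
    simp
  · change TensorProduct.map S.δ₁ LinearMap.id (a ⊗ₜ[R] (1 : R)) +
        TensorProduct.map eR (0 : R →ₗ[R] R) (θ ⊗ₜ[R] (1 : R)) +
        TensorProduct.map S.r LinearMap.id (θ ⊗ₜ[R] (1 : R)) =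
      (S.δ₁ a + S.r θ) ⊗ₜ[R] (1 : R)
    simp [TensorProduct.add_tmul]

theorem v_irr (a b c : S.Irr.carrier) (θ : S.Red.carrier) :
    (tensorRep S (Om1 R) eC eR).v (irr S eC eR (a, b, c, θ)) =
      irr S eC eR (S.v a + S.δ₂ θ, S.v b, S.v c, eR (S.δ₁ b)) := by
  refine Prod.ext ?_ (Prod.ext rfl (Prod.ext rfl ?_))
  · change TensorProduct.map S.v LinearMap.id (a ⊗ₜ[R] (1 : R)) +
        TensorProduct.map S.δ₂ LinearMap.id (θ ⊗ₜ[R] (1 : R)) =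
      (S.v a + S.δ₂ θ) ⊗ₜ[R] (1 : R)
    simp [TensorProduct.add_tmul]
  · change TensorProduct.map (eR ∘ₗ S.δ₁) LinearMap.id (b ⊗ₜ[R] (1 : R)) +
        TensorProduct.map LinearMap.id (0 : R →ₗ[R] R) (θ ⊗ₜ[R] (1 : R)) =
      eR (S.δ₁ b) ⊗ₜ[R] (1 : R)
    simp

theorem δ₁_irr (a b c : S.Irr.carrier) (θ : S.Red.carrier) :
    (tensorRep S (Om1 R) eC eR).δ₁ (irr S eC eR (a, b, c, θ)) = red S eC eR (S.δ₁ c) := by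
  change TensorProduct.map S.δ₁ LinearMap.id (c ⊗ₜ[R] (1 : R)) +
      TensorProduct.map eR (0 : R →ₗ[R] R) (θ ⊗ₜ[R] (1 : R)) = S.δ₁ c ⊗ₜ[R] (1 : R)
  simp

theorem δ₂_red (ρ : S.Red.carrier) :
    (tensorRep S (Om1 R) eC eR).δ₂ (red S eC eR ρ) = irr S eC eR (0, 0, S.δ₂ ρ, ρ) :=
  Prod.ext (map_zero (S.Irr.tensorUnit (-2))).symm
    (Prod.ext (map_zero (S.Irr.tensorUnit (-2))).symm rfl)

theorem r_red (ρ : S.Red.carrier) :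
    (tensorRep S (Om1 R) eC eR).r (red S eC eR ρ) = red S eC eR (S.r ρ) := by
  change TensorProduct.map S.r LinearMap.id (ρ ⊗ₜ[R] (1 : R)) +
      TensorProduct.map eR (0 : R →ₗ[R] R) (ρ ⊗ₜ[R] (1 : R)) = S.r ρ ⊗ₜ[R] (1 : R)
  simp

theorem mem_grading_irr_iff (a b c : S.Irr.carrier) (θ : S.Red.carrier) (j : ℤ) :
    irr S eC eR (a, b, c, θ) ∈ (tensorRep S (Om1 R) eC eR).Irr.grading j ↔
      a ∈ S.Irr.grading (j + 2) ∧ b ∈ S.Irr.grading (j + 1) ∧ c ∈ S.Irr.grading j ∧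
        θ ∈ S.Red.grading (j + 2) :=
  and_congr (GradedMod.tensorUnit_mem_grading_iff (by ring))
    (and_congr (GradedMod.tensorUnit_mem_grading_iff (by ring))
      (and_congr (GradedMod.tensorUnit_mem_grading_iff (by ring))
        (GradedMod.tensorUnit_mem_grading_iff (by ring))))

theorem mem_grading_red_iff (θ : S.Red.carrier) (j : ℤ) :
    red S eC eR θ ∈ (tensorRep S (Om1 R) eC eR).Red.grading j ↔ θ ∈ S.Red.grading j :=
  GradedMod.tensorUnit_mem_grading_iff (by ring)

/-- Linear maps out of the irreducible summand are determined on the image of `irr`. -/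
theorem irr_linearMap_ext {N : Type*} [AddCommGroup N] [Module R N]
    {f g : (tensorRep S (Om1 R) eC eR).Irr.carrier →ₗ[R] N}
    (h : ∀ a b c θ, f (irr S eC eR (a, b, c, θ)) = g (irr S eC eR (a, b, c, θ))) : f = g :=
  LinearMap.ext fun x => by
    obtain ⟨⟨a, b, c, θ⟩, rfl⟩ := (irr S eC eR).surjective x
    exact h a b c θ

/-- Linear maps out of the reducible summand are determined on the image of `red`. -/
theorem red_linearMap_ext {N : Type*} [AddCommGroup N] [Module R N]
    {f g : (tensorRep S (Om1 R) eC eR).Red.carrier →ₗ[R] N}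
    (h : ∀ ρ, f (red S eC eR ρ) = g (red S eC eR ρ)) : f = g :=
  LinearMap.ext fun x => by
    obtain ⟨ρ, rfl⟩ := (red S eC eR).surjective x
    exact h ρ

/-- The morphism `Σ⁻¹C~ → C~ ⊗ O~(-1)` with `λ(a, θ) = (a, 0, v a + δ₂ θ, θ)`. -/
noncomputable def ofNegSusp : SMap S.negSusp (tensorRep S (Om1 R) eC eR) where
  lam := (irr S eC eR).toLinearMap ∘ₗ quad (LinearMap.fst R _ _) 0
    (S.v ∘ₗ LinearMap.fst R _ _ + S.δ₂ ∘ₗ LinearMap.snd R _ _) (LinearMap.snd R _ _)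
  mu := 0
  del1 := 0
  del2 := 0
  rho := (red S eC eR).toLinearMap

/-- The morphism `C~ ⊗ O~(-1) → Σ⁻¹C~` with `λ(a, b, c, θ) = (a, θ)` and
`Δ₁(a, b, c, θ) = -δ₁ (ε b)`. -/
noncomputable def toNegSusp : SMap (tensorRep S (Om1 R) eC eR) S.negSusp where
  lam := LinearMap.prod qj₁ qj₄ ∘ₗ (irr S eC eR).symm.toLinearMap
  mu := 0
  del1 := -(S.δ₁ ∘ₗ eC ∘ₗ qj₂ ∘ₗ (irr S eC eR).symm.toLinearMap)
  del2 := 0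
  rho := (red S eC eR).symm.toLinearMap

/-- The homotopy on `C~ ⊗ O~(-1)` with `K(a, b, c, θ) = (0, 0, -ε b, 0)`. -/
noncomputable def htpy : SMap (tensorRep S (Om1 R) eC eR) (tensorRep S (Om1 R) eC eR) where
  lam := (irr S eC eR).toLinearMap ∘ₗ quad 0 0 (-(eC ∘ₗ qj₂)) 0 ∘ₗ (irr S eC eR).symm.toLinearMap
  mu := 0
  del1 := 0
  del2 := 0
  rho := 0

theorem ofNegSusp_lam (a : S.Irr.carrier) (θ : S.Red.carrier) :
    (ofNegSusp S eC eR).lam (a, θ) = irr S eC eR (a, 0, S.v a + S.δ₂ θ, θ) :=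
  rfl

theorem toNegSusp_lam (a b c : S.Irr.carrier) (θ : S.Red.carrier) :
    (toNegSusp S eC eR).lam (irr S eC eR (a, b, c, θ)) = (a, θ) :=
  congrArg (LinearMap.prod qj₁ qj₄) ((irr S eC eR).symm_apply_apply (a, b, c, θ))

theorem toNegSusp_del1 (a b c : S.Irr.carrier) (θ : S.Red.carrier) :
    (toNegSusp S eC eR).del1 (irr S eC eR (a, b, c, θ)) = -S.δ₁ (eC b) :=
  congrArg (-(S.δ₁ ∘ₗ eC ∘ₗ qj₂)) ((irr S eC eR).symm_apply_apply (a, b, c, θ))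

theorem toNegSusp_rho (ρ : S.Red.carrier) :
    (toNegSusp S eC eR).rho (red S eC eR ρ) = ρ :=
  (red S eC eR).symm_apply_apply ρ

theorem htpy_lam (a b c : S.Irr.carrier) (θ : S.Red.carrier) :
    (htpy S eC eR).lam (irr S eC eR (a, b, c, θ)) = irr S eC eR (0, 0, -eC b, 0) := by
  change irr S eC eR (quad 0 0 (-(eC ∘ₗ qj₂)) 0
    ((irr S eC eR).symm (irr S eC eR (a, b, c, θ)))) = _
  rw [LinearEquiv.symm_apply_apply]
  rfl

variable {S eC eR}

theorem ofNegSusp_isMor (hS : S.Relations) : (ofNegSusp S eC eR).IsMor := by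
  obtain ⟨-, -, hdδ₂, hdv, -⟩ := hS
  have hdδ₂ (θ) : S.d (S.δ₂ θ) = S.δ₂ (S.r θ) := LinearMap.congr_fun (sub_eq_zero.mp hdδ₂) θ
  have hdv (a) : S.d (S.v a) = S.v (S.d a) + S.δ₂ (S.δ₁ a) := by
    rw [sub_sub] at hdv
    exact LinearMap.congr_fun (sub_eq_zero.mp hdv) a
  refine ⟨LinearMap.ext fun ⟨a, θ⟩ => ?_, LinearMap.ext fun ⟨a, θ⟩ => ?_,
    LinearMap.ext fun (ρ : S.Red.carrier) => ?_, LinearMap.ext fun ⟨a, θ⟩ => ?_,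
    LinearMap.ext fun (ρ : S.Red.carrier) => ?_⟩
  · change (tensorRep S (Om1 R) eC eR).d ((ofNegSusp S eC eR).lam (a, θ)) -
      (ofNegSusp S eC eR).lam (S.d a, S.δ₁ a + S.r θ) = 0
    rw [ofNegSusp_lam, ofNegSusp_lam, d_irr, sub_eq_zero]
    simp only [map_add, map_zero, hdv, hdδ₂]
    congr 3
    · abel
    · rw [add_assoc]
  · change 0 + red S eC eR (S.δ₁ (S.v a) + S.δ₁ (S.δ₂ θ)) -
      (tensorRep S (Om1 R) eC eR).δ₁ ((ofNegSusp S eC eR).lam (a, θ)) -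
      (tensorRep S (Om1 R) eC eR).r 0 = 0
    rw [ofNegSusp_lam, δ₁_irr, map_add S.δ₁, map_zero, zero_add, sub_zero, sub_self]
  · change (tensorRep S (Om1 R) eC eR).d 0 - (tensorRep S (Om1 R) eC eR).δ₂ (red S eC eR ρ) +
      (ofNegSusp S eC eR).lam (0, ρ) + 0 = 0
    rw [ofNegSusp_lam, δ₂_red, map_zero, map_zero, zero_add, zero_sub, add_zero, neg_add_cancel]
  · change 0 + (tensorRep S (Om1 R) eC eR).d 0 +
      (ofNegSusp S eC eR).lam (S.v a + S.δ₂ θ, 0) -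
      (tensorRep S (Om1 R) eC eR).v ((ofNegSusp S eC eR).lam (a, θ)) + 0 -
      (tensorRep S (Om1 R) eC eR).δ₂ 0 = 0
    rw [ofNegSusp_lam, ofNegSusp_lam, v_irr]
    simp only [map_zero, add_zero, zero_add, sub_self]
  · change red S eC eR (S.r ρ) - (tensorRep S (Om1 R) eC eR).r (red S eC eR ρ) = 0
    rw [r_red, sub_self]

theorem toNegSusp_isMor (hS : S.IsSComplex) (heC : S.Irr.IsSign eC) (heR : S.Red.IsSign eR) :
    (toNegSusp S eC eR).IsMor := by
  obtain ⟨hIrr, -, ⟨hd, -, hδ₁, -, -⟩, -, hδ₁d, -, -, -⟩ := hS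
  have hδ₁d (a) : S.δ₁ (S.d a) = -S.r (S.δ₁ a) :=
    LinearMap.congr_fun (eq_neg_of_add_eq_zero_left hδ₁d) a
  have hed := heC.apply_of_odd hIrr heC (by decide) hd
  have heδ₁ := heC.apply_of_odd hIrr heR (by decide) hδ₁
  have hee := heC.comp_self hIrr
  refine ⟨irr_linearMap_ext S eC eR fun a b c θ => ?_, irr_linearMap_ext S eC eR fun a b c θ => ?_,
    red_linearMap_ext S eC eR fun ρ => ?_, irr_linearMap_ext S eC eR fun a b c θ => ?_,
    red_linearMap_ext S eC eR fun ρ => ?_⟩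
  · change S.negSusp.d ((toNegSusp S eC eR).lam (irr S eC eR (a, b, c, θ))) -
      (toNegSusp S eC eR).lam ((tensorRep S (Om1 R) eC eR).d (irr S eC eR (a, b, c, θ))) = 0
    rw [d_irr, toNegSusp_lam, toNegSusp_lam]
    exact sub_self _
  · change (toNegSusp S eC eR).del1 ((tensorRep S (Om1 R) eC eR).d (irr S eC eR (a, b, c, θ))) +
      (toNegSusp S eC eR).rho ((tensorRep S (Om1 R) eC eR).δ₁ (irr S eC eR (a, b, c, θ))) -
      S.negSusp.δ₁ ((toNegSusp S eC eR).lam (irr S eC eR (a, b, c, θ))) -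
      S.negSusp.r ((toNegSusp S eC eR).del1 (irr S eC eR (a, b, c, θ))) = 0
    rw [d_irr, δ₁_irr, toNegSusp_lam, toNegSusp_del1, toNegSusp_del1, toNegSusp_rho]
    change -S.δ₁ (eC (-eC (S.v a) + S.d b + eC c - eC (S.δ₂ θ))) + S.δ₁ c -
      (S.δ₁ (S.v a) + S.δ₁ (S.δ₂ θ)) - S.r (-S.δ₁ (eC b)) = 0
    simp only [map_add, map_sub, map_neg, hee, hed, hδ₁d]
    abel
  · change S.negSusp.d 0 - S.negSusp.δ₂ ((toNegSusp S eC eR).rho (red S eC eR ρ)) +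
      (toNegSusp S eC eR).lam ((tensorRep S (Om1 R) eC eR).δ₂ (red S eC eR ρ)) + 0 = 0
    rw [δ₂_red, toNegSusp_lam, toNegSusp_rho, map_zero, zero_sub, add_zero]
    exact neg_add_cancel _
  · change 0 + S.negSusp.d 0 +
      (toNegSusp S eC eR).lam ((tensorRep S (Om1 R) eC eR).v (irr S eC eR (a, b, c, θ))) -
      S.negSusp.v ((toNegSusp S eC eR).lam (irr S eC eR (a, b, c, θ))) + 0 -
      S.negSusp.δ₂ ((toNegSusp S eC eR).del1 (irr S eC eR (a, b, c, θ))) = 0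
    rw [map_zero, zero_add, zero_add, add_zero, sub_sub, sub_eq_zero, v_irr, toNegSusp_lam,
      toNegSusp_lam, toNegSusp_del1, heδ₁]
    exact Prod.ext (add_zero _).symm (zero_add _).symm
  · change (toNegSusp S eC eR).rho ((tensorRep S (Om1 R) eC eR).r (red S eC eR ρ)) -
      S.negSusp.r ((toNegSusp S eC eR).rho (red S eC eR ρ)) = 0
    rw [r_red, toNegSusp_rho, toNegSusp_rho]
    exact sub_self _

theorem htpy_isHtpyFrom (hS : S.IsSComplex) (heC : S.Irr.IsSign eC) :
    SMap.IsHtpyFrom (htpy S eC eR) ((ofNegSusp S eC eR).comp (toNegSusp S eC eR))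
      (idMap (tensorRep S (Om1 R) eC eR)) := by
  obtain ⟨hIrr, -, ⟨hd, hv, -, -, -⟩, -⟩ := hS
  have hed := heC.apply_of_odd hIrr heC (by decide) hd
  have hev := heC.apply_of_even hIrr heC (by decide) hv
  have hee := heC.comp_self hIrr
  refine ⟨irr_linearMap_ext S eC eR fun a b c θ => ?_, irr_linearMap_ext S eC eR fun a b c θ => ?_,
    red_linearMap_ext S eC eR fun ρ => ?_, irr_linearMap_ext S eC eR fun a b c θ => ?_,
    red_linearMap_ext S eC eR fun ρ => ?_⟩
  · change (tensorRep S (Om1 R) eC eR).d ((htpy S eC eR).lam (irr S eC eR (a, b, c, θ))) +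
      (htpy S eC eR).lam ((tensorRep S (Om1 R) eC eR).d (irr S eC eR (a, b, c, θ))) -
      (ofNegSusp S eC eR).lam ((toNegSusp S eC eR).lam (irr S eC eR (a, b, c, θ))) +
      irr S eC eR (a, b, c, θ) = 0
    rw [htpy_lam, d_irr, d_irr, htpy_lam, toNegSusp_lam, ofNegSusp_lam, ← map_add, ← map_sub,
      ← map_add, LinearEquiv.map_eq_zero_iff]
    simp only [map_add, map_sub, map_neg, map_zero, hee, hed, Prod.mk_add_mk, Prod.mk_sub_mk,
      Prod.mk_eq_zero]
    refine ⟨?_, ?_, ?_, ?_⟩ <;> abel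
  · change (tensorRep S (Om1 R) eC eR).δ₁ ((htpy S eC eR).lam (irr S eC eR (a, b, c, θ))) +
      (tensorRep S (Om1 R) eC eR).r 0 + 0 + 0 -
      (0 + red S eC eR ((toNegSusp S eC eR).del1 (irr S eC eR (a, b, c, θ)))) + 0 = 0
    rw [htpy_lam, δ₁_irr, toNegSusp_del1]
    simp only [map_neg, map_zero, add_zero, zero_add, sub_self]
  · change -((tensorRep S (Om1 R) eC eR).d 0) + (tensorRep S (Om1 R) eC eR).δ₂ 0 -
      (htpy S eC eR).lam ((tensorRep S (Om1 R) eC eR).δ₂ (red S eC eR ρ)) + 0 -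
      ((ofNegSusp S eC eR).lam 0 + 0) + 0 = 0
    rw [δ₂_red, htpy_lam]
    simp only [map_zero, neg_zero, add_zero, sub_zero, Prod.mk_zero_zero]
  · change (tensorRep S (Om1 R) eC eR).v ((htpy S eC eR).lam (irr S eC eR (a, b, c, θ))) -
      (tensorRep S (Om1 R) eC eR).d 0 + (tensorRep S (Om1 R) eC eR).δ₂ 0 + 0 -
      (htpy S eC eR).lam ((tensorRep S (Om1 R) eC eR).v (irr S eC eR (a, b, c, θ))) + 0 -
      ((ofNegSusp S eC eR).lam 0 + 0 + 0) + 0 = 0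
    rw [v_irr, htpy_lam, htpy_lam, v_irr]
    simp only [hev, map_neg, map_zero, add_zero, sub_zero, sub_self]
  · change (tensorRep S (Om1 R) eC eR).r 0 + 0 -
      red S eC eR ((toNegSusp S eC eR).rho (red S eC eR ρ)) + red S eC eR ρ = 0
    rw [toNegSusp_rho, map_zero, add_zero, zero_sub, neg_add_cancel]

/-- The composite `Σ⁻¹C~ → C~ ⊗ O~(-1) → Σ⁻¹C~` is the identity. -/
theorem toNegSusp_comp_ofNegSusp :
    (toNegSusp S eC eR).comp (ofNegSusp S eC eR) = idMap S.negSusp := by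
  refine (SMap.mk.injEq ..).mpr ⟨LinearMap.ext fun ⟨a, θ⟩ => ?_, LinearMap.ext fun ⟨a, θ⟩ => ?_,
    LinearMap.ext fun ⟨a, θ⟩ => ?_, LinearMap.ext fun ρ => ?_, LinearMap.ext fun ρ => ?_⟩
  · exact toNegSusp_lam ..
  · change (toNegSusp S eC eR).lam 0 + 0 + 0 = 0
    rw [map_zero, add_zero, add_zero]
  · change (toNegSusp S eC eR).del1 ((ofNegSusp S eC eR).lam (a, θ)) +
      (toNegSusp S eC eR).rho 0 = 0
    rw [map_zero, add_zero, ofNegSusp_lam, toNegSusp_del1]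
    simp only [map_zero, neg_zero]
    rfl
  · change (toNegSusp S eC eR).lam 0 + 0 = 0
    rw [map_zero, add_zero]
  · exact toNegSusp_rho ..

theorem ofNegSusp_degreesAt (hS : S.Degrees) : (ofNegSusp S eC eR).DegreesAt 0 := by
  obtain ⟨-, hv, -, hδ₂, -⟩ := hS
  refine ⟨?_, GradedMod.isDeg_zero, GradedMod.isDeg_zero, GradedMod.isDeg_zero, ?_⟩
  · rintro i _ ⟨⟨a, θ⟩, ⟨ha, hθ⟩, rfl⟩
    rw [ofNegSusp_lam, mem_grading_irr_iff, add_zero]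
    have hva := hv _ ⟨a, ha, rfl⟩
    have hδ₂θ := hδ₂ _ ⟨θ, hθ, rfl⟩
    rw [add_neg_cancel_right] at hva hδ₂θ
    exact ⟨ha, zero_mem _, add_mem hva hδ₂θ, hθ⟩
  · rintro i _ ⟨ρ, hρ, rfl⟩
    rw [add_zero]
    exact (mem_grading_red_iff ..).mpr hρ

theorem toNegSusp_degreesAt (hS : S.Degrees) (heC : S.Irr.IsSign eC) :
    (toNegSusp S eC eR).DegreesAt 0 := by
  obtain ⟨-, -, hδ₁, -, -⟩ := hS
  refine ⟨?_, GradedMod.isDeg_zero, ?_, GradedMod.isDeg_zero, ?_⟩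
  · rintro i _ ⟨x, hx, rfl⟩
    obtain ⟨⟨a, b, c, θ⟩, rfl⟩ := (irr S eC eR).surjective x
    obtain ⟨ha, -, -, hθ⟩ := (mem_grading_irr_iff ..).mp hx
    rw [toNegSusp_lam, add_zero]
    exact ⟨ha, hθ⟩
  · rintro i _ ⟨x, hx, rfl⟩
    obtain ⟨⟨a, b, c, θ⟩, rfl⟩ := (irr S eC eR).surjective x
    obtain ⟨-, hb, -, -⟩ := (mem_grading_irr_iff ..).mp hx
    have hδ₁b := hδ₁ _ ⟨eC b, heC.mem_grading hb, rfl⟩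
    rw [add_neg_cancel_right] at hδ₁b
    rw [toNegSusp_del1, add_zero]
    exact neg_mem hδ₁b
  · rintro i _ ⟨x, hx, rfl⟩
    obtain ⟨ρ, rfl⟩ := (red S eC eR).surjective x
    rw [toNegSusp_rho, add_zero]
    exact (mem_grading_red_iff S eC eR ρ i).mp hx

theorem htpy_degreesAt (heC : S.Irr.IsSign eC) : (htpy S eC eR).DegreesAt 1 := by
  refine ⟨?_, GradedMod.isDeg_zero, GradedMod.isDeg_zero, GradedMod.isDeg_zero,
    GradedMod.isDeg_zero⟩
  rintro i _ ⟨x, hx, rfl⟩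
  obtain ⟨⟨a, b, c, θ⟩, rfl⟩ := (irr S eC eR).surjective x
  obtain ⟨-, hb, -, -⟩ := (mem_grading_irr_iff ..).mp hx
  rw [htpy_lam, mem_grading_irr_iff]
  exact ⟨zero_mem _, zero_mem _, neg_mem (heC.mem_grading hb), zero_mem _⟩

end TensorOm1

/-- The zero map is an `S`-chain homotopy from a morphism to itself. -/
theorem SMap.isHtpyFrom_zero {S T : SCData R} (f : SMap S T) :
    SMap.IsHtpyFrom ⟨0, 0, 0, 0, 0⟩ f f := by
  refine ⟨?_, ?_, ?_, ?_, ?_⟩ <;> simp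

/-- For any `S`-complex `C~`, the negative suspension `Σ⁻¹C~` is `S`-chain
homotopy equivalent to the tensor product `C~ ⊗ O~(-1)`. -/
theorem negSusp_homotopyEquiv_tensor_Om1 {R : Type u} [CommRing R] (S : SCData R)
    (hS : S.IsSComplex)
    (eC : S.Irr.carrier →ₗ[R] S.Irr.carrier) (eR : S.Red.carrier →ₗ[R] S.Red.carrier)
    (heC : S.Irr.IsSign eC) (heR : S.Red.IsSign eR) :
    SHomotopyEquiv S.negSusp (tensorRep S (Om1 R) eC eR) := by
  obtain ⟨-, -, hdeg, hrel⟩ := id hS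
  refine ⟨TensorOm1.ofNegSusp S eC eR, TensorOm1.toNegSusp S eC eR, ⟨0, 0, 0, 0, 0⟩,
    TensorOm1.htpy S eC eR, TensorOm1.ofNegSusp_isMor hrel, TensorOm1.ofNegSusp_degreesAt hdeg,
    TensorOm1.toNegSusp_isMor hS heC heR, TensorOm1.toNegSusp_degreesAt hdeg heC,
    ⟨GradedMod.isDeg_zero, GradedMod.isDeg_zero, GradedMod.isDeg_zero,
      GradedMod.isDeg_zero, GradedMod.isDeg_zero⟩, ?_,
    TensorOm1.htpy_degreesAt heC, TensorOm1.htpy_isHtpyFrom hS heC⟩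
  rw [TensorOm1.toNegSusp_comp_ofNegSusp]
  exact SMap.isHtpyFrom_zero _
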